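/- arXiv:2308.01782 — 2 statements merged into one kernel-verified Lean document; each statement's English description precedes it below -/
import Mathlib

section
/- Let n ≥ 1, R > 0, 1 < p < ∞, b > 1, a < n and 0 < c ≤ (n-a)/(b-1). Then for every complex-valued function f ∈ C_0^1(B(0,R)\{0}) one has ((b-1)c/p)^p · ∫_{B(0,R)} |f(x)|^p / (|x|^a (1-(|x|/R)^c)^b) dx ≤ ∫_{B(0,R)} |𝓡f(x)|^p / (|x|^{a-p} (1-(|x|/R)^c)^{b-p}) dx. -/
open MeasureTheory Metric

/-- The radial derivative `𝓡f(x) = Df(x)[x/|x|]` of a complex-valued function on `ℝⁿ`. -/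
noncomputable def radDeriv {n : ℕ} (f : EuclideanSpace ℝ (Fin n) → ℂ)
    (x : EuclideanSpace ℝ (Fin n)) : ℂ :=
  fderiv ℝ f x (‖x‖⁻¹ • x)

/-- The integral form of Euler's identity: integrating the divergence of `x ↦ u x • x`. -/
theorem integral_fderiv_apply_self {n : ℕ} {u : EuclideanSpace ℝ (Fin n) → ℝ}
    (hu : ContDiff ℝ 1 u) (hc : HasCompactSupport u) :
    ∫ x, fderiv ℝ u x x = -(n * ∫ x, u x) := by
  have hdu : Continuous (fderiv ℝ u) := hu.continuous_fderiv one_ne_zero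
  have hcdu : HasCompactSupport (fderiv ℝ u) := hc.fderiv ℝ
  let e : Fin n → EuclideanSpace ℝ (Fin n) := fun i => EuclideanSpace.basisFun (Fin n) ℝ i
  have hproj : ∀ i x, fderiv ℝ (fun y : EuclideanSpace ℝ (Fin n) => y i) x (e i) = 1 := by
    intro i x
    have h : HasFDerivAt (fun y : EuclideanSpace ℝ (Fin n) => y i)
        (EuclideanSpace.proj i : EuclideanSpace ℝ (Fin n) →L[ℝ] ℝ) x :=
      (EuclideanSpace.proj i : EuclideanSpace ℝ (Fin n) →L[ℝ] ℝ).hasFDerivAt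
    rw [h.fderiv]
    simp [e]
  have hint : ∀ i, Integrable (fun x : EuclideanSpace ℝ (Fin n) => x i * fderiv ℝ u x (e i)) := by
    intro i
    refine Continuous.integrable_of_hasCompactSupport (by fun_prop) ?_
    refine hcdu.mono fun x hx => ?_
    contrapose! hx
    simp_all
  have hdecomp : ∀ x : EuclideanSpace ℝ (Fin n),
      fderiv ℝ u x x = ∑ i, x i * fderiv ℝ u x (e i) := by
    intro x
    generalize fderiv ℝ u x = L
    conv_lhs => rw [← (EuclideanSpace.basisFun (Fin n) ℝ).sum_repr x]
    rw [map_sum]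
    simp [e]
  simp_rw [hdecomp]
  rw [integral_finsetSum _ fun i _ => hint i]
  have hparts : ∀ i : Fin n, ∫ x : EuclideanSpace ℝ (Fin n), x i * fderiv ℝ u x (e i)
      = -∫ x, u x := by
    intro i
    rw [integral_mul_fderiv_eq_neg_fderiv_mul_of_integrable]
    · simp_rw [hproj, one_mul]
    · simp_rw [hproj, one_mul]
      exact hu.continuous.integrable_of_hasCompactSupport hc
    · exact hint i
    · refine Continuous.integrable_of_hasCompactSupport
        ((by fun_prop : Continuous fun x : EuclideanSpace ℝ (Fin n) => x i).mul hu.continuous) ?_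
      exact hc.mul_left
    · intro x _
      fun_prop
    · exact fun x _ => (hu.differentiable one_ne_zero) x
  simp [hparts]

/-- Young's inequality with a parameter. -/
theorem mul_rpow_sub_one_mul_le {p s A B : ℝ} (hp : 1 < p) (hs : 0 < s) (hA : 0 ≤ A)
    (hB : 0 ≤ B) :
    p * (A ^ (p - 1) * B) ≤ (p - 1) * s * A ^ p + s ^ (1 - p) * B ^ p := by
  have hp0 : 0 < p := by linarith
  have key := Real.geom_mean_le_arith_mean2_weighted (w₁ := (p - 1) / p) (w₂ := 1 / p)
    (p₁ := s * A ^ p) (p₂ := s ^ (1 - p) * B ^ p) (div_nonneg (by linarith) hp0.le)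
    (by positivity) (by positivity) (by positivity) (by field_simp; ring)
  rw [Real.mul_rpow hs.le (by positivity), Real.mul_rpow (by positivity) (by positivity),
    ← Real.rpow_mul hA, ← Real.rpow_mul hs.le, ← Real.rpow_mul hB,
    show p * ((p - 1) / p) = p - 1 by field_simp, show p * (1 / p) = 1 by field_simp,
    Real.rpow_one] at key
  have hs1 : s ^ ((p - 1) / p) * s ^ ((1 - p) * (1 / p)) = 1 := by
    rw [← Real.rpow_add hs, show (p - 1) / p + (1 - p) * (1 / p) = 0 by field_simp; ring,
      Real.rpow_zero]
  have hlhs : s ^ ((p - 1) / p) * A ^ (p - 1) * (s ^ ((1 - p) * (1 / p)) * B)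
      = A ^ (p - 1) * B := by
    linear_combination (A ^ (p - 1) * B) * hs1
  rw [hlhs] at key
  calc p * (A ^ (p - 1) * B)
      ≤ p * ((p - 1) / p * (s * A ^ p) + 1 / p * (s ^ (1 - p) * B ^ p)) := by gcongr
    _ = _ := by field_simp

/-- The derivative of the Hardy weight along dilations. -/
theorem hasDerivAt_hardyWeight {R a b c r : ℝ} (hc : 0 < c) (hr : 0 < r) (hrR : r < R) :
    HasDerivAt (fun s : ℝ => (s * r) ^ (-a) * (1 - (s * r / R) ^ c) ^ (1 - b))
      (r ^ (-a) * (1 - (r / R) ^ c) ^ (-b) *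
        (-a * (1 - (r / R) ^ c) + (b - 1) * c * (r / R) ^ c)) 1 := by
  have hR : 0 < R := hr.trans hrR
  have ht : 0 < 1 - (r / R) ^ c :=
    sub_pos.2 (Real.rpow_lt_one (by positivity) ((div_lt_one hR).2 hrR) hc)
  have h1 : HasDerivAt (fun s : ℝ => s * r) r 1 := by
    simpa using (hasDerivAt_id (1 : ℝ)).mul_const r
  have h2 := h1.rpow_const (p := -a) (Or.inl (by simpa using hr.ne'))
  have h3 := (((h1.div_const R).rpow_const (p := c)
    (Or.inl (by simpa using ⟨hr.ne', hR.ne'⟩))).const_sub 1).rpow_const (p := 1 - b)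
    (Or.inl (by simpa using ht.ne'))
  refine (h2.mul h3).congr_deriv ?_
  simp only [one_mul]
  have e1 : r ^ (-a - 1) = r ^ (-a) / r := Real.rpow_sub_one hr.ne' _
  have e2 : (r / R) ^ (c - 1) = (r / R) ^ c / (r / R) :=
    Real.rpow_sub_one (by positivity) _
  have e3 : (1 - (r / R) ^ c) ^ (1 - b) = (1 - (r / R) ^ c) ^ (-b) * (1 - (r / R) ^ c) := by
    rw [show 1 - b = -b + 1 by ring, Real.rpow_add_one ht.ne']
  have e4 : 1 - b - 1 = -b := by ring
  rw [e1, e2, e4, e3]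
  field_simp
  ring

/-- The derivative of the weighted power of `f`, in the direction of the base point. -/
theorem fderiv_norm_rpow_mul_hardyWeight_apply_self {E : Type*} [NormedAddCommGroup E]
    [InnerProductSpace ℝ E] {R p b a c : ℝ} (hp : 1 < p) (hc : 0 < c) {f : E → ℂ} {x : E}
    (hf : DifferentiableAt ℝ f x) (hx : 0 < ‖x‖) (hxR : ‖x‖ < R)
    (hu : DifferentiableAt ℝ
      (fun y => ‖f y‖ ^ p * (‖y‖ ^ (-a) * (1 - (‖y‖ / R) ^ c) ^ (1 - b))) x) :
    fderiv ℝ (fun y => ‖f y‖ ^ p * (‖y‖ ^ (-a) * (1 - (‖y‖ / R) ^ c) ^ (1 - b))) x x =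
      p * ‖f x‖ ^ (p - 2) * inner ℝ (f x) (fderiv ℝ f x x) *
          (‖x‖ ^ (-a) * (1 - (‖x‖ / R) ^ c) ^ (1 - b)) +
        ‖f x‖ ^ p * (‖x‖ ^ (-a) * (1 - (‖x‖ / R) ^ c) ^ (-b) *
          (-a * (1 - (‖x‖ / R) ^ c) + (b - 1) * c * (‖x‖ / R) ^ c)) := by
  have hray : HasDerivAt (fun s : ℝ => s • x) x 1 := by
    simpa using (hasDerivAt_id (1 : ℝ)).smul_const x
  have hl := hu.hasFDerivAt.comp_hasDerivAt_of_eq (1 : ℝ) hray (one_smul ℝ x).symm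
  have hfp := ((hasFDerivAt_norm_rpow (f x) hp).comp x hf.hasFDerivAt).comp_hasDerivAt_of_eq
    (1 : ℝ) hray (one_smul ℝ x).symm
  have hr := hfp.mul (hasDerivAt_hardyWeight (a := a) (b := b) hc hx hxR)
  have heq : (fun y => ‖f y‖ ^ p * (‖y‖ ^ (-a) * (1 - (‖y‖ / R) ^ c) ^ (1 - b))) ∘
      (fun s : ℝ => s • x) =ᶠ[nhds 1] ((fun y : ℂ => ‖y‖ ^ p) ∘ f) ∘ (fun s : ℝ => s • x) *
        fun s : ℝ => (s * ‖x‖) ^ (-a) * (1 - (s * ‖x‖ / R) ^ c) ^ (1 - b) := by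
    filter_upwards [lt_mem_nhds (zero_lt_one (α := ℝ))] with s hs
    simp [norm_smul, abs_of_pos hs]
  refine (hl.unique (hr.congr_of_eventuallyEq heq)).trans ?_
  simp

/-- Pointwise comparison behind the Hardy inequality, up to a divergence. -/
theorem hardy_pointwise {R p b a c d : ℝ} (hp : 1 < p) (hb : 1 < b) (hc0 : 0 < c)
    (hc : (b - 1) * c ≤ d - a) {r : ℝ} (hr : 0 < r) (hrR : r < R) (z v : ℂ) :
    ((b - 1) * c / p) * (‖z‖ ^ p / (r ^ a * (1 - (r / R) ^ c) ^ b)) ≤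
      ((b - 1) * c / p) ^ (1 - p) *
          (‖r⁻¹ • v‖ ^ p / (r ^ (a - p) * (1 - (r / R) ^ c) ^ (b - p))) +
        (d * (‖z‖ ^ p * (r ^ (-a) * (1 - (r / R) ^ c) ^ (1 - b))) +
          (p * ‖z‖ ^ (p - 2) * inner ℝ z v * (r ^ (-a) * (1 - (r / R) ^ c) ^ (1 - b)) +
            ‖z‖ ^ p * (r ^ (-a) * (1 - (r / R) ^ c) ^ (-b) *
              (-a * (1 - (r / R) ^ c) + (b - 1) * c * (r / R) ^ c)))) := by
  have hR : 0 < R := hr.trans hrR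
  have hp0 : 0 < p := by linarith
  set t := (r / R) ^ c with ht_def
  have ht0 : 0 < t := by positivity
  have ht : 0 < 1 - t :=
    sub_pos.2 (Real.rpow_lt_one (by positivity) ((div_lt_one hR).2 hrR) hc0)
  set s := (b - 1) * c / p with hs_def
  have hs : 0 < s := div_pos (mul_pos (by linarith) hc0) hp0
  have hsp : (b - 1) * c = s * p := by rw [hs_def]; field_simp
  set w := r ^ (-a) * (1 - t) ^ (-b) with hw_def
  have hw : 0 < w := by positivity
  have e1 : ‖z‖ ^ p / (r ^ a * (1 - t) ^ b) = ‖z‖ ^ p * w := by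
    rw [hw_def, Real.rpow_neg hr.le, Real.rpow_neg ht.le]
    field_simp
  have e2 : ‖r⁻¹ • v‖ ^ p / (r ^ (a - p) * (1 - t) ^ (b - p)) = (‖v‖ * (1 - t)) ^ p * w := by
    rw [hw_def, norm_smul, norm_inv, Real.norm_of_nonneg hr.le,
      Real.mul_rpow (by positivity) (norm_nonneg _), Real.mul_rpow (norm_nonneg _) ht.le,
      Real.inv_rpow hr.le, Real.rpow_sub hr, Real.rpow_sub ht, Real.rpow_neg hr.le,
      Real.rpow_neg ht.le]
    field_simp
  have e3 : r ^ (-a) * (1 - t) ^ (1 - b) = w * (1 - t) := by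
    rw [hw_def, show 1 - b = -b + 1 by ring, Real.rpow_add_one ht.ne']
    ring
  have hin : -(‖z‖ ^ (p - 1) * ‖v‖) ≤ ‖z‖ ^ (p - 2) * inner ℝ z v := by
    rcases eq_or_ne z 0 with rfl | hz
    · simp [Real.zero_rpow (by linarith : p - 1 ≠ 0)]
    · have hz' : 0 < ‖z‖ := norm_pos_iff.2 hz
      have h1 : -(‖z‖ * ‖v‖) ≤ inner ℝ z v := neg_le_of_abs_le (abs_real_inner_le_norm z v)
      have h2 : ‖z‖ ^ (p - 1) = ‖z‖ ^ (p - 2) * ‖z‖ := by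
        rw [show p - 1 = p - 2 + 1 by ring, Real.rpow_add_one hz'.ne']
      rw [h2]
      calc -(‖z‖ ^ (p - 2) * ‖z‖ * ‖v‖) = ‖z‖ ^ (p - 2) * -(‖z‖ * ‖v‖) := by ring
        _ ≤ _ := by gcongr
  have hyoung := mul_rpow_sub_one_mul_le hp hs (norm_nonneg z)
    (mul_nonneg (norm_nonneg v) ht.le)
  have hA : 0 ≤ ‖z‖ ^ p := by positivity
  rw [e1, e2, e3, hsp]
  rw [hsp] at hc
  have h1 := mul_le_mul_of_nonneg_left hin (mul_pos (mul_pos hp0 hw) ht).le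
  have h2 := mul_le_mul_of_nonneg_left hyoung hw.le
  have h3 := mul_le_mul_of_nonneg_left hc (mul_nonneg (mul_nonneg hA hw.le) ht.le)
  nlinarith [h1, h2, h3]

theorem unified_hardy_inequality {n : ℕ} (hn : 1 ≤ n) {R : ℝ} (hR : 0 < R)
    {p b a c : ℝ} (hp : 1 < p) (hb : 1 < b) (ha : a < (n : ℝ))
    (hc0 : 0 < c) (hc : c ≤ ((n : ℝ) - a) / (b - 1))
    (f : EuclideanSpace ℝ (Fin n) → ℂ)
    (hf : ContDiff ℝ 1 f) (hcomp : HasCompactSupport f)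
    (hsupp : tsupport f ⊆ ball (0 : EuclideanSpace ℝ (Fin n)) R \ {0}) :
    ((b - 1) * c / p) ^ p *
      ∫ x in ball (0 : EuclideanSpace ℝ (Fin n)) R,
        ‖f x‖ ^ p / (‖x‖ ^ a * (1 - (‖x‖ / R) ^ c) ^ b) ≤
    ∫ x in ball (0 : EuclideanSpace ℝ (Fin n)) R,
        ‖radDeriv f x‖ ^ p / (‖x‖ ^ (a - p) * (1 - (‖x‖ / R) ^ c) ^ (b - p)) := by
  have hp0 : 0 < p := by linarith
  have hcd : (b - 1) * c ≤ (n : ℝ) - a := by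
    rw [le_div_iff₀ (by linarith)] at hc
    linarith
  set s := (b - 1) * c / p with hs_def
  have hs : 0 < s := div_pos (mul_pos (by linarith) hc0) hp0
  have hpos : ∀ x ∈ tsupport f, 0 < ‖x‖ ∧ ‖x‖ < R := fun x hx =>
    ⟨norm_pos_iff.2 (hsupp hx).2, by simpa using (hsupp hx).1⟩
  have ht : ∀ x ∈ tsupport f, 0 < 1 - (‖x‖ / R) ^ c := fun x hx =>
    sub_pos.2 (Real.rpow_lt_one (by positivity) ((div_lt_one hR).2 (hpos x hx).2) hc0)
  have hf0 : ∀ x, x ∉ tsupport f → f x = 0 := fun x hx => image_eq_zero_of_notMem_tsupport hx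
  have hrad0 : ∀ x, x ∉ tsupport f → radDeriv f x = 0 := fun x hx => by
    simp [radDeriv, fderiv_of_notMem_tsupport ℝ hx]
  have hsub : ∀ {g : EuclideanSpace ℝ (Fin n) → ℝ}, (∀ x, x ∉ tsupport f → g x = 0) →
      tsupport g ⊆ tsupport f := fun {g} hg =>
    closure_minimal (fun x hx => by_contra fun h => hx (hg x h)) (isClosed_tsupport f)
  have hcompact : ∀ {g : EuclideanSpace ℝ (Fin n) → ℝ}, (∀ x, x ∉ tsupport f → g x = 0) →
      HasCompactSupport g := fun hg => hcomp.of_isClosed_subset (isClosed_tsupport _) (hsub hg)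
  have hwcont : ∀ α β : ℝ, ∀ x ∈ tsupport f, ContinuousAt
      (fun y : EuclideanSpace ℝ (Fin n) => ‖y‖ ^ α * (1 - (‖y‖ / R) ^ c) ^ β) x := by
    intro α β x hx
    refine (continuousAt_id.norm.rpow_const (Or.inl (hpos x hx).1.ne')).mul ?_
    refine ContinuousAt.rpow_const ?_ (Or.inl (ht x hx).ne')
    exact continuousAt_const.sub
      ((continuousAt_id.norm.div_const R).rpow_const (Or.inr hc0.le))
  have hwne : ∀ α β : ℝ, ∀ x ∈ tsupport f, ‖x‖ ^ α * (1 - (‖x‖ / R) ^ c) ^ β ≠ 0 :=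
    fun α β x hx => (mul_pos (Real.rpow_pos_of_pos (hpos x hx).1 _)
      (Real.rpow_pos_of_pos (ht x hx) _)).ne'
  set F : EuclideanSpace ℝ (Fin n) → ℝ := fun x =>
    ‖f x‖ ^ p / (‖x‖ ^ a * (1 - (‖x‖ / R) ^ c) ^ b) with hF
  set G : EuclideanSpace ℝ (Fin n) → ℝ := fun x =>
    ‖radDeriv f x‖ ^ p / (‖x‖ ^ (a - p) * (1 - (‖x‖ / R) ^ c) ^ (b - p)) with hG
  set u : EuclideanSpace ℝ (Fin n) → ℝ := fun x =>
    ‖f x‖ ^ p * (‖x‖ ^ (-a) * (1 - (‖x‖ / R) ^ c) ^ (1 - b)) with hu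
  have hF0 : ∀ x, x ∉ tsupport f → F x = 0 := fun x hx => by
    simp [hF, hf0 x hx, Real.zero_rpow hp0.ne']
  have hG0 : ∀ x, x ∉ tsupport f → G x = 0 := fun x hx => by
    simp [hG, hrad0 x hx, Real.zero_rpow hp0.ne']
  have hu0 : ∀ x, x ∉ tsupport f → u x = 0 := fun x hx => by
    simp [hu, hf0 x hx, Real.zero_rpow hp0.ne']
  have hFc : Continuous F := continuous_of_tsupport fun x hx =>
    (hf.continuous.norm.rpow_const fun _ => Or.inr hp0.le).continuousAt.div
      (hwcont _ _ x (hsub hF0 hx)) (hwne _ _ x (hsub hF0 hx))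
  have hradc : ∀ x ∈ tsupport f, ContinuousAt (radDeriv f) x := by
    intro x hx
    refine ContinuousAt.clm_apply (hf.continuous_fderiv one_ne_zero).continuousAt ?_
    exact (continuousAt_id.norm.inv₀ (hpos x hx).1.ne').smul continuousAt_id
  have hGc : Continuous G := continuous_of_tsupport fun x hx =>
    ((hradc x (hsub hG0 hx)).norm.rpow_const (Or.inr hp0.le)).div
      (hwcont _ _ x (hsub hG0 hx)) (hwne _ _ x (hsub hG0 hx))
  have hud : ContDiff ℝ 1 u := by
    refine contDiff_iff_contDiffAt.2 fun x => ?_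
    by_cases hx : x ∈ tsupport f
    swap
    · exact contDiffAt_const.congr_of_eventuallyEq
        (notMem_tsupport_iff_eventuallyEq.1 fun h => hx (hsub hu0 h))
    have hn : ContDiffAt ℝ 1 (fun y : EuclideanSpace ℝ (Fin n) => ‖y‖) x :=
      contDiffAt_norm ℝ (norm_pos_iff.1 (hpos x hx).1)
    refine (hf.norm_rpow hp).contDiffAt.mul ((hn.rpow_const_of_ne (hpos x hx).1.ne').mul ?_)
    refine ContDiffAt.rpow_const_of_ne ?_ (ht x hx).ne'
    exact contDiffAt_const.sub
      ((hn.div_const R).rpow_const_of_ne (div_pos (hpos x hx).1 hR).ne')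
  have hFi : Integrable F := hFc.integrable_of_hasCompactSupport (hcompact hF0)
  have hGi : Integrable G := hGc.integrable_of_hasCompactSupport (hcompact hG0)
  have hui : Integrable u := hud.continuous.integrable_of_hasCompactSupport (hcompact hu0)
  have hdu0 : ∀ x, x ∉ tsupport f → fderiv ℝ u x x = 0 := fun x hx => by
    simp [fderiv_of_notMem_tsupport ℝ fun h => hx (hsub hu0 h)]
  have hdui : Integrable fun x => fderiv ℝ u x x :=
    ((hud.continuous_fderiv one_ne_zero).clm_apply
      continuous_id).integrable_of_hasCompactSupport (hcompact hdu0)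
  have hpt : ∀ x, s * F x ≤ s ^ (1 - p) * G x + (n * u x + fderiv ℝ u x x) := by
    intro x
    by_cases hx : x ∈ tsupport f
    · have hfx := (hf.differentiable one_ne_zero) x
      rw [fderiv_norm_rpow_mul_hardyWeight_apply_self hp hc0 hfx (hpos x hx).1 (hpos x hx).2
        ((hud.differentiable one_ne_zero) x)]
      have h := hardy_pointwise hp hb hc0 hcd (hpos x hx).1 (hpos x hx).2 (f x)
        (fderiv ℝ f x x)
      rw [← map_smul] at h
      exact h
    · simp [hF0 x hx, hG0 x hx, hu0 x hx, hdu0 x hx]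
  have hint : s * ∫ x, F x ≤ s ^ (1 - p) * ∫ x, G x := by
    have hsum : Integrable fun x => n * u x + fderiv ℝ u x x := (hui.const_mul (n : ℝ)).add hdui
    have h := integral_mono (hFi.const_mul s) ((hGi.const_mul (s ^ (1 - p))).add hsum) hpt
    simp only [Pi.add_apply] at h
    rw [integral_add (hGi.const_mul _) hsum,
      integral_add (hui.const_mul (n : ℝ)) hdui, integral_const_mul, integral_const_mul,
      integral_const_mul, integral_fderiv_apply_self hud (hcompact hu0)] at h
    linarith
  have hball : ∀ x, x ∉ ball (0 : EuclideanSpace ℝ (Fin n)) R → x ∉ tsupport f :=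
    fun x hx h => hx (hsupp h).1
  rw [setIntegral_eq_integral_of_forall_compl_eq_zero fun x hx => hF0 x (hball x hx),
    setIntegral_eq_integral_of_forall_compl_eq_zero fun x hx => hG0 x (hball x hx)]
  calc s ^ p * ∫ x, F x = s ^ (p - 1) * (s * ∫ x, F x) := by
        rw [← mul_assoc, ← Real.rpow_add_one hs.ne', sub_add_cancel]
    _ ≤ s ^ (p - 1) * (s ^ (1 - p) * ∫ x, G x) := by gcongr
    _ = ∫ x, G x := by
        rw [← mul_assoc, ← Real.rpow_add hs, show p - 1 + (1 - p) = 0 by ring,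
          Real.rpow_zero, one_mul]
end

section
/- Let n ≥ 1, R > 0, 1 < p < ∞, c > 0 and a < n - (p-1)c. Then for every complex-valued function f ∈ C_0^2(B(0,R)\{0}) one has ((p-1)c/p)^p · |(n(p-1)+a-2p)/p|^p · ∫_{B(0,R)} |f(x)|^p / (|x|^a (1-(|x|/R)^c)^p) dx + |(n(p-1)+a-2p)/p|^p · (n-a-(p-1)c) · ((p-1)c/p)^{p-1} · ∫_{B(0,R)} |f(x)|^p / (|x|^a (1-(|x|/R)^c)^{p-1}) dx ≤ ∫_{B(0,R)} |𝓡²f(x) + ((n-1)/|x|)·𝓡f(x)|^p / |x|^{a-2p} dx. -/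
open MeasureTheory Metric

/-- The divergence theorem for the field `u(x) x`, with `u` compactly supported. -/
theorem integral_dim_mul_add_fderiv_self_eq_zero {n : ℕ} {u : EuclideanSpace ℝ (Fin n) → ℝ}
    (hu : ContDiff ℝ 1 u) (hc : HasCompactSupport u) :
    Integrable (fun x => (n : ℝ) * u x + fderiv ℝ u x x) ∧
      ∫ x, ((n : ℝ) * u x + fderiv ℝ u x x) = 0 := by
  let e := EuclideanSpace.basisFun (Fin n) ℝ
  have hdu : Continuous (fderiv ℝ u) := hu.continuous_fderiv one_ne_zero
  have hui : Integrable u := hu.continuous.integrable_of_hasCompactSupport hc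
  have hcoord (i : Fin n) : Integrable (fun x : EuclideanSpace ℝ (Fin n) =>
      x i * fderiv ℝ u x (e i)) :=
    Continuous.integrable_of_hasCompactSupport (by fun_prop) ((hc.fderiv_apply ℝ (e i)).mul_left)
  have hpart (i : Fin n) :
      ∫ x : EuclideanSpace ℝ (Fin n), x i * fderiv ℝ u x (e i) = -∫ x, u x := by
    have hd (x : EuclideanSpace ℝ (Fin n)) :
        fderiv ℝ (fun x : EuclideanSpace ℝ (Fin n) => x i) x (e i) = 1 := by
      have := (EuclideanSpace.proj (𝕜 := ℝ) i).hasFDerivAt (x := x)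
      rw [show (fun x : EuclideanSpace ℝ (Fin n) => x i) = EuclideanSpace.proj (𝕜 := ℝ) i from rfl,
        this.fderiv]
      simp [e]
    have := integral_mul_fderiv_eq_neg_fderiv_mul_of_integrable (μ := volume)
      (f := fun x : EuclideanSpace ℝ (Fin n) => x i) (g := u) (v := e i)
      (by simpa only [hd, one_mul] using hui) (hcoord i)
      (Continuous.integrable_of_hasCompactSupport (by fun_prop) hc.mul_left)
      (fun x _ => by fun_prop) (fun x _ => hu.differentiable one_ne_zero x)
    simpa only [hd, one_mul] using this
  have hsum (x : EuclideanSpace ℝ (Fin n)) :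
      fderiv ℝ u x x = ∑ i, x i * fderiv ℝ u x (e i) := by
    have := congrArg (fderiv ℝ u x) (e.sum_repr x)
    rw [map_sum] at this
    rw [← this]
    simp only [map_smul, smul_eq_mul, e, EuclideanSpace.basisFun_repr]
  have hfi : Integrable (fun x => fderiv ℝ u x x) := by
    simp only [hsum]
    exact integrable_finsetSum _ fun i _ => hcoord i
  refine ⟨(hui.const_mul _).add hfi, ?_⟩
  rw [integral_add (hui.const_mul _) hfi, integral_const_mul]
  simp only [hsum]
  rw [integral_finsetSum _ fun i _ => hcoord i]
  simp [hpart]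

/-- Young's inequality in the form used for weighted Hardy inequalities. -/
theorem mul_rpow_mul_le_rpow_add {p X B : ℝ} (hp : 1 < p) (hX : 0 ≤ X) (hB : 0 ≤ B) :
    p * X ^ (p - 1) * B ≤ B ^ p + (p - 1) * X ^ p := by
  have hpq := Real.HolderConjugate.conjExponent hp
  have h := Real.young_inequality_of_nonneg hB (Real.rpow_nonneg hX (p - 1)) hpq
  have h1 : (p - 1) * p.conjExponent = p := by
    rw [Real.conjExponent]; field_simp [(sub_pos.2 hp).ne']
  rw [← Real.rpow_mul hX, h1, Real.conjExponent] at h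
  have hp0 : 0 < p := by linarith
  calc p * X ^ (p - 1) * B = p * (B * X ^ (p - 1)) := by ring
    _ ≤ p * (B ^ p / p + X ^ p / (p / (p - 1))) := by gcongr
    _ = _ := by field_simp

theorem contDiff_of_forall_mem_tsupport {E F : Type*} [NormedAddCommGroup E] [NormedSpace ℝ E]
    [NormedAddCommGroup F] [NormedSpace ℝ F] {k : WithTop ℕ∞} {f : E → F}
    (hf : ∀ x ∈ tsupport f, ContDiffAt ℝ k f x) : ContDiff ℝ k f := by
  refine contDiff_iff_contDiffAt.2 fun x => ?_
  by_cases hx : x ∈ tsupport f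
  · exact hf x hx
  · exact (contDiffAt_const (c := (0 : F))).congr_of_eventuallyEq
      (notMem_tsupport_iff_eventuallyEq.1 hx)

section RadialDerivative

variable {n : ℕ} {f : EuclideanSpace ℝ (Fin n) → ℂ} {x : EuclideanSpace ℝ (Fin n)}

theorem radDeriv_of_notMem_tsupport (hx : x ∉ tsupport f) : radDeriv f x = 0 := by
  simp [radDeriv, fderiv_of_notMem_tsupport ℝ hx]

theorem tsupport_radDeriv_subset : tsupport (radDeriv f) ⊆ tsupport f :=
  closure_minimal (fun _ hx => by_contra fun h => hx (radDeriv_of_notMem_tsupport h))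
    (isClosed_tsupport f)

theorem contDiff_radDeriv {k : WithTop ℕ∞} (hf : ContDiff ℝ (k + 1) f)
    (h0 : (0 : EuclideanSpace ℝ (Fin n)) ∉ tsupport f) : ContDiff ℝ k (radDeriv f) := by
  refine contDiff_of_forall_mem_tsupport fun x hx => ?_
  have hx0 : x ≠ 0 := by
    rintro rfl
    exact h0 (tsupport_radDeriv_subset hx)
  exact (hf.fderiv_right le_rfl).contDiffAt.clm_apply
    (((contDiffAt_norm ℝ hx0).inv (norm_ne_zero_iff.2 hx0)).smul contDiffAt_id)

theorem fderiv_apply_self_eq_norm_smul_radDeriv (hx : x ≠ 0) :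
    fderiv ℝ f x x = ‖x‖ • radDeriv f x := by
  rw [radDeriv, ← map_smul, smul_inv_smul₀ (norm_ne_zero_iff.2 hx)]

end RadialDerivative

theorem norm_mem_Ioo_of_mem_ball_diff {n : ℕ} {R : ℝ} {x : EuclideanSpace ℝ (Fin n)}
    (hx : x ∈ ball (0 : EuclideanSpace ℝ (Fin n)) R \ {0}) : ‖x‖ ∈ Set.Ioo 0 R :=
  ⟨norm_pos_iff.2 hx.2, by simpa using hx.1⟩

theorem integrable_norm_rpow_mul_radial {n : ℕ} {R p : ℝ} (hp : 0 < p)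
    {h : EuclideanSpace ℝ (Fin n) → ℂ} (hh : Continuous h) {K : Set (EuclideanSpace ℝ (Fin n))}
    (hK : IsCompact K) (hhK : tsupport h ⊆ K)
    (hs : K ⊆ ball (0 : EuclideanSpace ℝ (Fin n)) R \ {0})
    {g : ℝ → ℝ} (hg : ContinuousOn g (Set.Ioo 0 R)) :
    Integrable (fun x => ‖h x‖ ^ p * g ‖x‖) := by
  have hsub : tsupport (fun x => ‖h x‖ ^ p * g ‖x‖) ⊆ tsupport h := by
    refine closure_mono fun x hx => ?_
    contrapose! hx
    simp [Function.notMem_support.1 hx, Real.zero_rpow hp.ne']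
  refine Continuous.integrable_of_hasCompactSupport (continuous_of_tsupport fun x hx => ?_)
    (hK.of_isClosed_subset (isClosed_tsupport _) (hsub.trans hhK))
  have hr := norm_mem_Ioo_of_mem_ball_diff (hs (hhK (hsub hx)))
  exact (hh.norm.rpow_const fun _ => Or.inr hp.le).continuousAt.mul
    ((hg.continuousAt (isOpen_Ioo.mem_nhds hr)).comp_of_eq continuous_norm.continuousAt rfl)

/-- The derivative of `‖h‖ ^ p φ(‖x‖)` in the direction `x`. -/
theorem fderiv_norm_rpow_mul_radial_apply_self {n : ℕ} {p : ℝ} (hp : 1 < p)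
    {h : EuclideanSpace ℝ (Fin n) → ℂ} (hh : ContDiff ℝ 1 h) {φ : ℝ → ℝ}
    {x : EuclideanSpace ℝ (Fin n)} (hx : x ≠ 0) (hφ : DifferentiableAt ℝ φ ‖x‖) :
    fderiv ℝ (fun x => ‖h x‖ ^ p * φ ‖x‖) x x =
      ‖h x‖ ^ p * (‖x‖ * deriv φ ‖x‖) +
        p * ‖h x‖ ^ (p - 2) * (‖x‖ * φ ‖x‖) * inner ℝ (h x) (radDeriv h x) := by
  have hn : DifferentiableAt ℝ (fun x : EuclideanSpace ℝ (Fin n) => ‖x‖) x :=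
    (contDiffAt_norm ℝ hx (n := 1)).differentiableAt one_ne_zero
  have hd := hh.differentiable one_ne_zero
  have h1 := hφ.hasDerivAt.comp_hasFDerivAt x hn.hasFDerivAt
  have h2 := ((hd.norm_rpow hp) x).hasFDerivAt.mul h1
  rw [hd.fderiv_norm_rpow hp] at h2
  change HasFDerivAt (fun x => ‖h x‖ ^ p * φ ‖x‖) _ x at h2
  rw [h2.fderiv]
  simp only [add_apply, smul_apply,
    ContinuousLinearMap.comp_apply, hn.fderiv_norm_self, fderiv_apply_self_eq_norm_smul_radDeriv hx,
    innerSL_apply_apply, inner_smul_right, smul_eq_mul, Function.comp_apply]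
  ring

/-- The pointwise estimate behind `integral_norm_rpow_mul_le_integral_radial`. -/
theorem pointwise_weighted_hardy {N p μ r φ dφ W m Q : ℝ} (hp : 1 < p) (hr : 0 < r) (hW : 0 ≤ W)
    (hm : 0 ≤ m) (hφ : |r * φ| ≤ m ^ (p - 1) * W)
    (hQ : Q ≤ (N - p * μ) * φ + r * dφ - (p - 1) * m ^ p * W) (z w : ℂ) :
    ‖z‖ ^ p * Q ≤ ‖w + ((μ / r : ℝ) : ℂ) * z‖ ^ p * W +
      (N * (‖z‖ ^ p * φ) + (‖z‖ ^ p * (r * dφ) +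
        p * ‖z‖ ^ (p - 2) * (r * φ) * inner ℝ z w)) := by
  set T : ℂ := w + ((μ / r : ℝ) : ℂ) * z with hT
  have hp0 : 0 < p := by linarith
  rcases eq_or_ne z 0 with rfl | hz
  · simp only [norm_zero, Real.zero_rpow hp0.ne', inner_zero_left]
    simp only [zero_mul, mul_zero, add_zero]
    positivity
  have hz' : 0 < ‖z‖ := norm_pos_iff.2 hz
  have hw : w = T - (μ / r) • z := by
    rw [hT, Complex.real_smul]
    push_cast
    ring
  have hin : inner ℝ z w = inner ℝ z T - μ / r * ‖z‖ ^ 2 := by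
    rw [hw, inner_sub_right, inner_smul_right, real_inner_self_eq_norm_sq]
  have e1 : ‖z‖ ^ (p - 2) * ‖z‖ ^ 2 = ‖z‖ ^ p := by
    rw [← Real.rpow_natCast, ← Real.rpow_add hz']
    norm_num
  have e2 : ‖z‖ ^ (p - 2) * ‖z‖ = ‖z‖ ^ (p - 1) := by
    rw [← Real.rpow_add_one hz'.ne']
    ring_nf
  have hC : |‖z‖ ^ (p - 2) * (r * φ) * inner ℝ z T| ≤
      m ^ (p - 1) * W * ‖z‖ ^ (p - 1) * ‖T‖ := by
    rw [abs_mul, abs_mul, abs_of_nonneg (by positivity : 0 ≤ ‖z‖ ^ (p - 2))]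
    calc ‖z‖ ^ (p - 2) * |r * φ| * |inner ℝ z T|
        ≤ ‖z‖ ^ (p - 2) * (m ^ (p - 1) * W) * (‖z‖ * ‖T‖) := by
          gcongr
          exact abs_real_inner_le_norm z T
      _ = m ^ (p - 1) * W * (‖z‖ ^ (p - 2) * ‖z‖) * ‖T‖ := by ring
      _ = _ := by rw [e2]
  have hY := mul_le_mul_of_nonneg_left
    (mul_rpow_mul_le_rpow_add hp (mul_nonneg hm (norm_nonneg z)) (norm_nonneg T)) hW
  rw [Real.mul_rpow hm (norm_nonneg z), Real.mul_rpow hm (norm_nonneg z)] at hY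
  have hC' := mul_le_mul_of_nonneg_left ((neg_le_abs _).trans hC) hp0.le
  have hQ' := mul_le_mul_of_nonneg_left hQ (by positivity : 0 ≤ ‖z‖ ^ p)
  have e3 : p * ‖z‖ ^ (p - 2) * (r * φ) * inner ℝ z w =
      p * (‖z‖ ^ (p - 2) * (r * φ) * inner ℝ z T) - p * μ * φ * ‖z‖ ^ p := by
    rw [hin, ← e1]
    field_simp
  rw [e3]
  linarith

/-- A weighted `L^p`-Hardy inequality for the first order radial operator `𝓡 + μ / |x|`. -/
theorem integral_norm_rpow_mul_le_integral_radial {n : ℕ} {R p μ : ℝ} (hp : 1 < p)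
    {h : EuclideanSpace ℝ (Fin n) → ℂ} (hh : ContDiff ℝ 1 h) (hc : HasCompactSupport h)
    (hs : tsupport h ⊆ ball (0 : EuclideanSpace ℝ (Fin n)) R \ {0}) {φ W m Q : ℝ → ℝ}
    (hφ : ContDiffOn ℝ 1 φ (Set.Ioo 0 R)) (hWc : ContinuousOn W (Set.Ioo 0 R))
    (hQc : ContinuousOn Q (Set.Ioo 0 R)) (hW : ∀ r ∈ Set.Ioo 0 R, 0 ≤ W r)
    (hm : ∀ r ∈ Set.Ioo 0 R, 0 ≤ m r)
    (hφm : ∀ r ∈ Set.Ioo 0 R, |r * φ r| ≤ m r ^ (p - 1) * W r)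
    (hQ : ∀ r ∈ Set.Ioo 0 R,
      Q r ≤ (n - p * μ) * φ r + r * deriv φ r - (p - 1) * m r ^ p * W r) :
    ∫ x in ball (0 : EuclideanSpace ℝ (Fin n)) R, ‖h x‖ ^ p * Q ‖x‖ ≤
      ∫ x in ball (0 : EuclideanSpace ℝ (Fin n)) R,
        ‖radDeriv h x + ((μ / ‖x‖ : ℝ) : ℂ) * h x‖ ^ p * W ‖x‖ := by
  have hp0 : 0 < p := by linarith
  set u : EuclideanSpace ℝ (Fin n) → ℝ := fun x => ‖h x‖ ^ p * φ ‖x‖ with hu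
  set T : EuclideanSpace ℝ (Fin n) → ℂ :=
    fun x => radDeriv h x + ((μ / ‖x‖ : ℝ) : ℂ) * h x with hT
  have hzero (x) (hx : x ∉ tsupport h) : h x = 0 := image_eq_zero_of_notMem_tsupport hx
  have hTzero (x) (hx : x ∉ tsupport h) : T x = 0 := by
    simp [hT, hzero x hx, radDeriv_of_notMem_tsupport hx]
  have hTs : tsupport T ⊆ tsupport h :=
    closure_minimal (fun x hx => by_contra fun h' => hx (hTzero x h')) (isClosed_tsupport h)
  have h0 : (0 : EuclideanSpace ℝ (Fin n)) ∉ tsupport h := fun h' => (hs h').2 rfl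
  have hTc : Continuous T := by
    refine continuous_of_tsupport fun x hx => ?_
    have hx0 : ‖x‖ ≠ 0 := (norm_mem_Ioo_of_mem_ball_diff (hs (hTs hx))).1.ne'
    have := (contDiff_radDeriv (k := 0) (by simpa using hh) h0).continuous
    exact this.continuousAt.add ((Complex.continuous_ofReal.continuousAt.comp
      (continuousAt_const.div continuous_norm.continuousAt hx0)).mul hh.continuous.continuousAt)
  have hus : tsupport u ⊆ tsupport h := by
    refine closure_mono fun x hx => ?_
    contrapose! hx
    simp [hu, Function.notMem_support.1 hx, Real.zero_rpow hp0.ne']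
  have huc : ContDiff ℝ 1 u := by
    refine contDiff_of_forall_mem_tsupport fun x hx => ?_
    have hr := hs (hus hx)
    exact (hh.norm_rpow hp).contDiffAt.mul
      ((hφ.contDiffAt (isOpen_Ioo.mem_nhds (norm_mem_Ioo_of_mem_ball_diff hr))).comp x
        (contDiffAt_norm ℝ hr.2))
  obtain ⟨hdi, hd0⟩ := integral_dim_mul_add_fderiv_self_eq_zero huc
    (hc.of_isClosed_subset (isClosed_tsupport _) hus)
  have hTi := integrable_norm_rpow_mul_radial hp0 hTc hc hTs hs hWc
  have hQi := integrable_norm_rpow_mul_radial hp0 hh.continuous hc le_rfl hs hQc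
  have hout (x) (hx : x ∉ ball (0 : EuclideanSpace ℝ (Fin n)) R) : x ∉ tsupport h :=
    fun h' => hx (hs h').1
  rw [setIntegral_eq_integral_of_forall_compl_eq_zero
      (fun x hx => by simp [hzero x (hout x hx), Real.zero_rpow hp0.ne']),
    setIntegral_eq_integral_of_forall_compl_eq_zero
      (fun x hx => by
        change ‖T x‖ ^ p * W ‖x‖ = 0
        simp [hTzero x (hout x hx), Real.zero_rpow hp0.ne'])]
  calc ∫ x, ‖h x‖ ^ p * Q ‖x‖
      ≤ ∫ x, (‖T x‖ ^ p * W ‖x‖ + (n * u x + fderiv ℝ u x x)) := by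
        refine integral_mono hQi (hTi.add hdi) fun x => ?_
        by_cases hx : x ∈ tsupport h
        · have hr := norm_mem_Ioo_of_mem_ball_diff (hs hx)
          have hφd : DifferentiableAt ℝ φ ‖x‖ :=
            (hφ.contDiffAt (isOpen_Ioo.mem_nhds hr)).differentiableAt one_ne_zero
          have := pointwise_weighted_hardy hp hr.1 (hW _ hr) (hm _ hr) (hφm _ hr) (hQ _ hr)
            (h x) (radDeriv h x)
          rwa [← fderiv_norm_rpow_mul_radial_apply_self hp hh (hs hx).2 hφd] at this
        · have hux : x ∉ tsupport u := fun h' => hx (hus h')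
          simp [hzero x hx, hTzero x hx, Real.zero_rpow hp0.ne',
            fderiv_of_notMem_tsupport ℝ hux, image_eq_zero_of_notMem_tsupport hux]
    _ = _ := by rw [integral_add hTi hdi, hd0, add_zero]

/-- The power-weight Hardy inequality for the divergence-type operator `𝓡 + (n - 1) / |x|`. -/
theorem integral_norm_rpow_mul_le_integral_radial_power {n : ℕ} {R p a : ℝ} (hp : 1 < p)
    {h : EuclideanSpace ℝ (Fin n) → ℂ} (hh : ContDiff ℝ 1 h) (hc : HasCompactSupport h)
    (hs : tsupport h ⊆ ball (0 : EuclideanSpace ℝ (Fin n)) R \ {0}) :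
    ∫ x in ball (0 : EuclideanSpace ℝ (Fin n)) R,
        ‖h x‖ ^ p * (|((n : ℝ) * (p - 1) + a - 2 * p) / p| ^ p * ‖x‖ ^ (p - a)) ≤
      ∫ x in ball (0 : EuclideanSpace ℝ (Fin n)) R,
        ‖radDeriv h x + ((((n : ℝ) - 1) / ‖x‖ : ℝ) : ℂ) * h x‖ ^ p * ‖x‖ ^ (2 * p - a) := by
  have hp0 : 0 < p := by linarith
  set β : ℝ := ((n : ℝ) * (p - 1) + a - 2 * p) / p with hβ
  have hpβ : p * β = (n : ℝ) * (p - 1) + a - 2 * p := by rw [hβ]; field_simp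
  have hcont (q : ℝ) : ContinuousOn (fun r : ℝ => r ^ q) (Set.Ioo 0 R) :=
    fun r hr => (Real.continuousAt_rpow_const r q (Or.inl hr.1.ne')).continuousWithinAt
  refine integral_norm_rpow_mul_le_integral_radial hp hh hc hs
    (φ := fun r => -(β.sign * |β| ^ (p - 1)) * r ^ (p - a)) (W := fun r => r ^ (2 * p - a))
    (m := fun r => |β| / r) (Q := fun r => |β| ^ p * r ^ (p - a))
    (fun r hr => (contDiffAt_const.mul
      (Real.contDiffAt_rpow_const (Or.inl hr.1.ne'))).contDiffWithinAt)
    (hcont _) (continuousOn_const.mul (hcont _)) (fun r hr => Real.rpow_nonneg hr.1.le _)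
    (fun r hr => div_nonneg (abs_nonneg _) hr.1.le) (fun r hr => ?_) (fun r hr => ?_)
  · have h1 : r ^ (2 * p - a) = r ^ (p - 1) * (r * r ^ (p - a)) := by
      nth_rw 3 [← Real.rpow_one r]
      rw [← Real.rpow_add hr.1, ← Real.rpow_add hr.1]
      ring_nf
    have hr0 : 0 < r ^ (p - 1) := Real.rpow_pos_of_pos hr.1 _
    have hr1 : 0 < r ^ (p - a) := Real.rpow_pos_of_pos hr.1 _
    have hsign : |β.sign| ≤ 1 := by
      rcases Real.sign_apply_eq β with h | h | h <;> simp [h]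
    have hb : 0 ≤ |β| ^ (p - 1) := by positivity
    rw [Real.div_rpow (abs_nonneg _) hr.1.le, h1, abs_mul, abs_mul, abs_neg, abs_mul,
      abs_of_pos hr.1, abs_of_nonneg hb, abs_of_pos hr1]
    calc r * (|β.sign| * |β| ^ (p - 1) * r ^ (p - a))
        ≤ r * (1 * |β| ^ (p - 1) * r ^ (p - a)) := by
          have := hr.1
          gcongr
      _ = _ := by field_simp
  · have hd : HasDerivAt (fun r => -(β.sign * |β| ^ (p - 1)) * r ^ (p - a))
        (-(β.sign * |β| ^ (p - 1)) * ((p - a) * r ^ (p - a - 1))) r :=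
      (Real.hasDerivAt_rpow_const (Or.inl hr.1.ne')).const_mul _
    have h1 : r ^ (2 * p - a) = r ^ p * r ^ (p - a) := by
      rw [← Real.rpow_add hr.1]
      ring_nf
    have h2 : r * r ^ (p - a - 1) = r ^ (p - a) := by
      rw [Real.rpow_sub_one hr.1.ne']
      field_simp [hr.1.ne']
    have hr0 : 0 < r ^ p := Real.rpow_pos_of_pos hr.1 _
    have hsβ : β.sign * β = |β| := by
      rcases lt_trichotomy β 0 with h | h | h
      · simp [Real.sign_of_neg h, abs_of_neg h]
      · simp [h]
      · simp [Real.sign_of_pos h, abs_of_pos h]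
    have h3 : β * β.sign * |β| ^ (p - 1) = |β| ^ p := by
      rcases eq_or_ne β 0 with h | h
      · simp [h, Real.zero_rpow hp0.ne']
      · rw [mul_comm β, hsβ, Real.rpow_sub_one (abs_ne_zero.2 h)]
        field_simp
    rw [hd.deriv, h1, Real.div_rpow (abs_nonneg _) hr.1.le]
    apply le_of_eq
    calc |β| ^ p * r ^ (p - a) = (p * β) * β.sign * |β| ^ (p - 1) * r ^ (p - a) -
          (p - 1) * |β| ^ p * r ^ (p - a) := by
          linear_combination (-p * r ^ (p - a)) * h3
      _ = (n - p * (n - 1)) * (-(β.sign * |β| ^ (p - 1)) * r ^ (p - a)) +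
          -(β.sign * |β| ^ (p - 1)) * (p - a) * (r * r ^ (p - a - 1)) -
          (p - 1) * |β| ^ p * r ^ (p - a) := by
          rw [hpβ, h2]
          ring
      _ = _ := by field_simp

theorem one_sub_div_rpow_pos {r R c : ℝ} (hr : r ∈ Set.Ioo 0 R) (hc : 0 < c) :
    0 < 1 - (r / R) ^ c := by
  have hR := hr.1.trans hr.2
  exact sub_pos.2 (Real.rpow_lt_one (div_nonneg hr.1.le hR.le) ((div_lt_one hR).2 hr.2) hc)

theorem contDiffOn_one_sub_div_rpow {R c : ℝ} :
    ContDiffOn ℝ 1 (fun r : ℝ => 1 - (r / R) ^ c) (Set.Ioo 0 R) := by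
  intro r hr
  have : r / R ≠ 0 := (div_pos hr.1 (hr.1.trans hr.2)).ne'
  exact (contDiffAt_const.sub ((Real.contDiffAt_rpow_const (Or.inl this)).comp r
    (contDiffAt_id.div_const R))).contDiffWithinAt

theorem continuousOn_one_div_rpow_mul {R a c q : ℝ} (hc : 0 < c) :
    ContinuousOn (fun r : ℝ => 1 / (r ^ a * (1 - (r / R) ^ c) ^ q)) (Set.Ioo 0 R) := by
  have h1 : ContinuousOn (fun r : ℝ => r ^ a) (Set.Ioo 0 R) :=
    fun r hr => (Real.continuousAt_rpow_const r a (Or.inl hr.1.ne')).continuousWithinAt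
  refine continuousOn_const.div (h1.mul (contDiffOn_one_sub_div_rpow.continuousOn.rpow_const
    fun r hr => Or.inl (one_sub_div_rpow_pos hr hc).ne')) fun r hr => ?_
  exact (mul_pos (Real.rpow_pos_of_pos hr.1 _)
    (Real.rpow_pos_of_pos (one_sub_div_rpow_pos hr hc) _)).ne'

/-- The Hardy inequality on a ball with remainder, with weights singular at the boundary. -/
theorem integral_norm_rpow_mul_le_integral_radDeriv {n : ℕ} {R p a c : ℝ} (hp : 1 < p)
    (hc0 : 0 < c) {h : EuclideanSpace ℝ (Fin n) → ℂ} (hh : ContDiff ℝ 1 h)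
    (hc : HasCompactSupport h)
    (hs : tsupport h ⊆ ball (0 : EuclideanSpace ℝ (Fin n)) R \ {0}) :
    ∫ x in ball (0 : EuclideanSpace ℝ (Fin n)) R, ‖h x‖ ^ p *
        (((p - 1) * c / p) ^ p * (1 / (‖x‖ ^ a * (1 - (‖x‖ / R) ^ c) ^ p)) +
          ((n : ℝ) - a - (p - 1) * c) * ((p - 1) * c / p) ^ (p - 1) *
            (1 / (‖x‖ ^ a * (1 - (‖x‖ / R) ^ c) ^ (p - 1)))) ≤
      ∫ x in ball (0 : EuclideanSpace ℝ (Fin n)) R,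
        ‖radDeriv h x‖ ^ p * ‖x‖ ^ (p - a) := by
  have hp0 : 0 < p := by linarith
  set b : ℝ := (p - 1) * c / p with hb
  have hb0 : 0 < b := div_pos (mul_pos (by linarith) hc0) hp0
  have hpb : (p - 1) * c = p * b := by rw [hb]; field_simp
  have key := integral_norm_rpow_mul_le_integral_radial hp hh hc hs (μ := 0)
    (φ := fun r => b ^ (p - 1) * (r ^ (-a) * (1 - (r / R) ^ c) ^ (1 - p)))
    (W := fun r => r ^ (p - a)) (m := fun r => b / (r * (1 - (r / R) ^ c)))
    (Q := fun r => b ^ p * (1 / (r ^ a * (1 - (r / R) ^ c) ^ p)) +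
          ((n : ℝ) - a - (p - 1) * c) * b ^ (p - 1) *
            (1 / (r ^ a * (1 - (r / R) ^ c) ^ (p - 1)))) ?_ ?_ ?_ ?_ ?_ ?_ ?_
  · simpa using key
  · intro r hr
    exact (contDiffAt_const.mul ((Real.contDiffAt_rpow_const (Or.inl hr.1.ne')).mul
      ((contDiffOn_one_sub_div_rpow.contDiffAt (isOpen_Ioo.mem_nhds hr)).rpow_const_of_ne
        (one_sub_div_rpow_pos hr hc0).ne'))).contDiffWithinAt
  · exact fun r hr => (Real.continuousAt_rpow_const r _ (Or.inl hr.1.ne')).continuousWithinAt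
  · exact (continuousOn_const.mul (continuousOn_one_div_rpow_mul hc0)).add
      (continuousOn_const.mul (continuousOn_one_div_rpow_mul hc0))
  · exact fun r hr => Real.rpow_nonneg hr.1.le _
  · exact fun r hr => div_nonneg hb0.le (mul_nonneg hr.1.le (one_sub_div_rpow_pos hr hc0).le)
  · intro r hr
    have hr0 := hr.1
    have hD := one_sub_div_rpow_pos hr hc0
    set D : ℝ := 1 - (r / R) ^ c
    rw [abs_of_nonneg (by positivity), Real.div_rpow hb0.le (by positivity),
      Real.mul_rpow hr0.le hD.le]
    apply le_of_eq
    have h1 : r ^ (p - a) = r ^ (p - 1) * (r * r ^ (-a)) := by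
      nth_rw 3 [← Real.rpow_one r]
      rw [← Real.rpow_add hr0, ← Real.rpow_add hr0]
      ring_nf
    have h2 : D ^ (1 - p) = (D ^ (p - 1))⁻¹ := by
      rw [← Real.rpow_neg hD.le]
      ring_nf
    have h3 : 0 < D ^ (p - 1) := by positivity
    have h4 : 0 < r ^ (p - 1) := by positivity
    rw [h1, h2]
    field_simp
  · intro r hr
    have hr0 := hr.1
    have hR : 0 < R := hr.1.trans hr.2
    have hD := one_sub_div_rpow_pos hr hc0
    have hrR : r / R ≠ 0 := (div_pos hr0 hR).ne'
    have hDd : HasDerivAt (fun r : ℝ => 1 - (r / R) ^ c) (-(1 / R * c * (r / R) ^ (c - 1))) r :=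
      (((hasDerivAt_id r).div_const R).rpow_const (Or.inl hrR)).const_sub 1
    have hd := ((Real.hasDerivAt_rpow_const (p := -a) (Or.inl hr0.ne')).mul
      (hDd.rpow_const (p := 1 - p) (Or.inl hD.ne'))).const_mul (b ^ (p - 1))
    change HasDerivAt (fun r => b ^ (p - 1) * (r ^ (-a) * (1 - (r / R) ^ c) ^ (1 - p))) _ r at hd
    rw [hd.deriv, Real.div_rpow hb0.le (by positivity), Real.mul_rpow hr0.le hD.le,
      Real.rpow_sub_one hrR, Real.rpow_sub_one hr0.ne', Real.rpow_sub_one hD.ne' (1 - p),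
      Real.rpow_sub_one hD.ne' p, Real.rpow_sub_one hb0.ne', Real.rpow_sub hD 1 p,
      Real.rpow_one, Real.rpow_neg hr0.le, Real.rpow_sub hr0]
    have hw : (r / R) ^ c = 1 - (1 - (r / R) ^ c) := by ring
    generalize 1 - (r / R) ^ c = D at *
    rw [hw]
    have hc' : c = p * b / (p - 1) := by
      rw [← hpb]
      field_simp [(sub_pos.2 hp).ne']
    have hp1 : p - 1 ≠ 0 := (sub_pos.2 hp).ne'
    have h1 : 0 < D ^ p := by positivity
    have h2 : 0 < r ^ p := by positivity
    have h3 : 0 < r ^ a := by positivity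
    apply le_of_eq
    field_simp
    rw [hc']
    field_simp
    ring

theorem unified_Lp_rellich_with_remainder {n : ℕ} (hn : 1 ≤ n) {R : ℝ} (hR : 0 < R)
    {p a c : ℝ} (hp : 1 < p) (hc : 0 < c) (ha : a < (n : ℝ) - (p - 1) * c)
    (f : EuclideanSpace ℝ (Fin n) → ℂ)
    (hf : ContDiff ℝ 2 f) (hcomp : HasCompactSupport f)
    (hsupp : tsupport f ⊆ ball (0 : EuclideanSpace ℝ (Fin n)) R \ {0}) :
    ((p - 1) * c / p) ^ p * |((n : ℝ) * (p - 1) + a - 2 * p) / p| ^ p *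
      (∫ x in ball (0 : EuclideanSpace ℝ (Fin n)) R,
        ‖f x‖ ^ p / (‖x‖ ^ a * (1 - (‖x‖ / R) ^ c) ^ p)) +
    |((n : ℝ) * (p - 1) + a - 2 * p) / p| ^ p *
      ((n : ℝ) - a - (p - 1) * c) * ((p - 1) * c / p) ^ (p - 1) *
      (∫ x in ball (0 : EuclideanSpace ℝ (Fin n)) R,
        ‖f x‖ ^ p / (‖x‖ ^ a * (1 - (‖x‖ / R) ^ c) ^ (p - 1))) ≤
    ∫ x in ball (0 : EuclideanSpace ℝ (Fin n)) R,
        ‖radDeriv (radDeriv f) x + ((((n : ℝ) - 1) / ‖x‖ : ℝ) : ℂ) * radDeriv f x‖ ^ p /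
          ‖x‖ ^ (a - 2 * p) := by
  have hp0 : 0 < p := by linarith
  have h0 : (0 : EuclideanSpace ℝ (Fin n)) ∉ tsupport f := fun h' => (hsupp h').2 rfl
  have hf1 : ContDiff ℝ 1 f := hf.of_le one_le_two
  have hrs : tsupport (radDeriv f) ⊆ tsupport f := tsupport_radDeriv_subset
  have step1 := integral_norm_rpow_mul_le_integral_radial_power (a := a) hp
    (contDiff_radDeriv (k := 1) (by simpa [one_add_one_eq_two] using hf) h0)
    (hcomp.of_isClosed_subset (isClosed_tsupport _) hrs) (hrs.trans hsupp)
  have step2 := integral_norm_rpow_mul_le_integral_radDeriv (a := a) hp hc hf1 hcomp hsupp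
  have hint (q : ℝ) : Integrable (fun x =>
      ‖f x‖ ^ p * (1 / (‖x‖ ^ a * (1 - (‖x‖ / R) ^ c) ^ q))) :=
    integrable_norm_rpow_mul_radial hp0 hf.continuous hcomp le_rfl hsupp
      (continuousOn_one_div_rpow_mul hc)
  have hsplit : ∫ x in ball (0 : EuclideanSpace ℝ (Fin n)) R, ‖f x‖ ^ p *
        (((p - 1) * c / p) ^ p * (1 / (‖x‖ ^ a * (1 - (‖x‖ / R) ^ c) ^ p)) +
          ((n : ℝ) - a - (p - 1) * c) * ((p - 1) * c / p) ^ (p - 1) *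
            (1 / (‖x‖ ^ a * (1 - (‖x‖ / R) ^ c) ^ (p - 1)))) =
      ((p - 1) * c / p) ^ p * (∫ x in ball (0 : EuclideanSpace ℝ (Fin n)) R,
        ‖f x‖ ^ p / (‖x‖ ^ a * (1 - (‖x‖ / R) ^ c) ^ p)) +
      ((n : ℝ) - a - (p - 1) * c) * ((p - 1) * c / p) ^ (p - 1) *
        (∫ x in ball (0 : EuclideanSpace ℝ (Fin n)) R,
          ‖f x‖ ^ p / (‖x‖ ^ a * (1 - (‖x‖ / R) ^ c) ^ (p - 1))) := by
    simp only [mul_one_div (‖f _‖ ^ p)] at hint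
    rw [← integral_const_mul, ← integral_const_mul,
      ← integral_add ((hint p).integrableOn.const_mul _) ((hint (p - 1)).integrableOn.const_mul _)]
    congr 1 with x
    ring
  have hB : 0 ≤ |((n : ℝ) * (p - 1) + a - 2 * p) / p| ^ p := by positivity
  calc _ = |((n : ℝ) * (p - 1) + a - 2 * p) / p| ^ p *
        ∫ x in ball (0 : EuclideanSpace ℝ (Fin n)) R, ‖f x‖ ^ p *
        (((p - 1) * c / p) ^ p * (1 / (‖x‖ ^ a * (1 - (‖x‖ / R) ^ c) ^ p)) +
          ((n : ℝ) - a - (p - 1) * c) * ((p - 1) * c / p) ^ (p - 1) *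
            (1 / (‖x‖ ^ a * (1 - (‖x‖ / R) ^ c) ^ (p - 1)))) := by
        rw [hsplit]
        ring
    _ ≤ |((n : ℝ) * (p - 1) + a - 2 * p) / p| ^ p *
        ∫ x in ball (0 : EuclideanSpace ℝ (Fin n)) R, ‖radDeriv f x‖ ^ p * ‖x‖ ^ (p - a) :=
      mul_le_mul_of_nonneg_left step2 hB
    _ = ∫ x in ball (0 : EuclideanSpace ℝ (Fin n)) R, ‖radDeriv f x‖ ^ p *
        (|((n : ℝ) * (p - 1) + a - 2 * p) / p| ^ p * ‖x‖ ^ (p - a)) := by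
      rw [← integral_const_mul]
      congr 1 with x
      ring
    _ ≤ _ := step1
    _ = _ := by
      congr 1 with x
      rw [← neg_sub a, Real.rpow_neg (norm_nonneg x), ← div_eq_mul_inv]
end
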